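/- For losses ℓ_{t,i} ∈ [-μ, ρ], the Hedge algorithm with parameters a = 1/(μ+ρ), b = μ/(μ+ρ), and γ ∈ (0,1) satisfies Σ_{t=0}^{T-1} (μ + ⟨ℓ_t, x_t⟩) ≤ (μ+ρ)·ln(n)/(1-γ) + (ln(1/γ)/(1-γ))·min_{1≤i≤n} Σ_{t=0}^{T-1} (μ + ℓ_{t,i}). -/

import Mathlib

open Finset Real

/-- The multiplicative weights update in closed form. -/
theorem multiplicativeWeights_eq {ι : Type*} {g : ℝ} (hg : 0 < g) {z w : ℕ → ι → ℝ}
    (hw : ∀ t i, w (t + 1) i = w t i * g ^ z t i) (T : ℕ) (i : ι) :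
    w T i = w 0 i * g ^ ∑ t ∈ range T, z t i := by
  induction T with
  | zero => simp
  | succ T ih => rw [hw, ih, sum_range_succ, rpow_add hg, mul_assoc]

/-- The total weight decays exponentially in the cumulative loss of the normalized weights. -/
theorem sum_multiplicativeWeights_le {ι : Type*} [Fintype ι] [Nonempty ι] {g : ℝ} (hg : 0 < g)
    {z w : ℕ → ι → ℝ} (hz0 : ∀ t i, 0 ≤ z t i) (hz1 : ∀ t i, z t i ≤ 1)
    (hw0 : ∀ i, 0 < w 0 i) (hw : ∀ t i, w (t + 1) i = w t i * g ^ z t i) (T : ℕ) :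
    ∑ i, w T i ≤ (∑ i, w 0 i) *
      exp (-(1 - g) * ∑ t ∈ range T, ∑ i, z t i * (w t i / ∑ j, w t j)) := by
  induction T with
  | zero => simp
  | succ T ih =>
    have hpos : ∀ i, 0 < w T i := fun i => by
      rw [multiplicativeWeights_eq hg hw]
      exact mul_pos (hw0 i) (rpow_pos_of_pos hg _)
    have hW : 0 < ∑ j, w T j := sum_pos (fun i _ => hpos i) univ_nonempty
    set Z := ∑ i, z T i * (w T i / ∑ j, w T j) with hZ
    have hWZ : (∑ j, w T j) * Z = ∑ i, w T i * z T i := by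
      rw [hZ, mul_sum]
      refine sum_congr rfl fun i _ => ?_
      field_simp
    calc ∑ i, w (T + 1) i ≤ ∑ i, (w T i - (1 - g) * (w T i * z T i)) := by
          refine sum_le_sum fun i _ => ?_
          have h := rpow_one_add_le_one_add_mul_self (s := g - 1) (by linarith)
            (hz0 T i) (hz1 T i)
          rw [add_sub_cancel] at h
          rw [hw]
          linarith [mul_le_mul_of_nonneg_left h (hpos i).le]
      _ = (∑ j, w T j) * (-(1 - g) * Z + 1) := by
          rw [sum_sub_distrib, ← mul_sum, ← hWZ]
          ring
      _ ≤ (∑ j, w T j) * exp (-(1 - g) * Z) := by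
          gcongr
          exact add_one_le_exp _
      _ ≤ _ := by
          rw [sum_range_succ, mul_add, exp_add, ← mul_assoc]
          gcongr

/-- Extension of Freund–Schapire's Theorem 2: for losses in `[-μ, ρ]`, the Hedge
algorithm with `a = 1/(μ+ρ)`, `b = μ/(μ+ρ)` and `γ ∈ (0,1)` satisfies
`∑_t (μ + ⟨ℓ_t, x_t⟩) ≤ (μ+ρ) ln n/(1-γ) + (ln(1/γ)/(1-γ)) min_i ∑_t (μ + ℓ_{t,i})`. -/
theorem hedge_convergence (n : ℕ) (hn : 2 ≤ n) (T : ℕ) (hT : 1 ≤ T)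
    (mu rho : ℝ) (hmurho : 0 < mu + rho)
    (gamma a b : ℝ) (hγ0 : 0 < gamma) (hγ1 : gamma < 1)
    (ha : a = 1 / (mu + rho)) (hb : b = mu / (mu + rho))
    (ℓ : ℕ → Fin n → ℝ)
    (hℓ : ∀ t, ∀ i, -mu ≤ ℓ t i ∧ ℓ t i ≤ rho)
    (w : ℕ → Fin n → ℝ)
    (hw0 : ∀ i, w 0 i = 1 / n)
    (hwrec : ∀ t i, w (t + 1) i = w t i * gamma ^ (a * ℓ t i + b))
    (x : ℕ → Fin n → ℝ)
    (hx : ∀ t i, x t i = w t i / ∑ j, w t j)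
    (huniv : (Finset.univ : Finset (Fin n)).Nonempty) :
    ∑ t ∈ Finset.range T, (mu + ∑ i, ℓ t i * x t i) ≤
      (mu + rho) * Real.log n / (1 - gamma) +
        (Real.log (1 / gamma) / (1 - gamma)) *
          (Finset.univ.inf' huniv fun i =>
            ∑ t ∈ Finset.range T, (mu + ℓ t i)) := by
  have : Nonempty (Fin n) := univ_nonempty_iff.mp huniv
  have hn0 : (0 : ℝ) < n := by exact_mod_cast (by omega : 0 < n)
  have hg : 0 < 1 - gamma := sub_pos.mpr hγ1
  obtain ⟨i, -, hi⟩ := exists_mem_eq_inf' huniv fun i => ∑ t ∈ range T, (mu + ℓ t i)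
  rw [hi]
  have hz : ∀ t i, a * ℓ t i + b = (mu + ℓ t i) / (mu + rho) := fun t i => by
    rw [ha, hb]
    ring
  simp only [hz] at hwrec
  have hw0' : ∀ i, 0 < w 0 i := fun i => by
    rw [hw0]
    positivity
  have hwpos : ∀ t i, 0 < w t i := fun t i => by
    rw [multiplicativeWeights_eq hγ0 hwrec]
    exact mul_pos (hw0' i) (rpow_pos_of_pos hγ0 _)
  have hx1 : ∀ t, ∑ i, x t i = 1 := fun t => by
    simp only [hx]
    rw [← sum_div, div_self (sum_pos (fun i _ => hwpos t i) huniv).ne']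
  have hupper := sum_multiplicativeWeights_le hγ0
    (fun t i => div_nonneg (by linarith [(hℓ t i).1]) hmurho.le)
    (fun t i => (div_le_one hmurho).mpr (by linarith [(hℓ t i).2])) hw0' hwrec T
  have hloss : ∑ t ∈ range T, ∑ i, (mu + ℓ t i) / (mu + rho) * (w t i / ∑ j, w t j) =
      (∑ t ∈ range T, (mu + ∑ i, ℓ t i * x t i)) / (mu + rho) := by
    rw [sum_div]
    refine sum_congr rfl fun t _ => ?_
    simp only [← hx, div_mul_eq_mul_div, ← sum_div, add_mul, sum_add_distrib, ← mul_sum, hx1,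
      mul_one]
  have hinit : ∑ i, w 0 i = 1 := by
    simp [hw0, hn0.ne']
  have hle := (single_le_sum (fun j _ => (hwpos T j).le) (mem_univ i)).trans hupper
  rw [hloss, hinit, one_mul, ← log_le_iff_le_exp (hwpos T i), multiplicativeWeights_eq hγ0 hwrec,
    hw0, log_mul (by positivity) (rpow_pos_of_pos hγ0 _).ne', log_rpow hγ0, one_div, log_inv,
    ← sum_div] at hle
  rw [one_div, log_inv, div_mul_eq_mul_div, ← add_div, le_div_iff₀ hg]
  have hscaled := mul_le_mul_of_nonneg_left hle hmurho.le
  field_simp at hscaled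
  linarith
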